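/- Let ℋ be a finite-dimensional complex Hilbert space and ρ, σ nonzero PSD operators on ℋ. Let J ⊆ (0,∞) be an interval and z : J → (0,∞) a continuous function. Then α ↦ D_{α,z(α)}(ρ‖σ) is continuous on J (with values in ℝ ∪ {+∞}). In particular, if 1 ∈ J then lim_{α→1} D_{α,z(α)}(ρ‖σ) = D_{1,z(1)}(ρ‖σ) = D^Um(ρ‖σ). Moreover, the limit lim_{α→1} D_{α,z(α)}(ρ‖σ) = D^Um(ρ‖σ) holds under the weaker assumption that z : J∖{1} → (0,∞) merely satisfies liminf_{α→1} z(α) > 0. -/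

import Mathlib

open Filter Set Topology
open scoped ComplexOrder

noncomputable section

namespace QRenyi

attribute [local instance] Classical.propDecidable

variable {ι : Type*} [Fintype ι] [DecidableEq ι]

/-- Apply a real function to the eigenvalues of a Hermitian matrix (functional calculus);
junk value `0` for non-Hermitian matrices. -/
noncomputable def hermApply (f : ℝ → ℝ) (A : Matrix ι ι ℂ) : Matrix ι ι ℂ :=
  if hA : A.IsHermitian then hA.cfc f else 0

/-- Real power of a positive semidefinite matrix, taken on its support:
`t ↦ t ^ x` is applied to the nonzero eigenvalues and `0` is mapped to `0`.
In particular `matPow A 0` is the support projection of `A`. -/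
noncomputable def matPow (A : Matrix ι ι ℂ) (x : ℝ) : Matrix ι ι ℂ :=
  hermApply (fun t => if t = 0 then 0 else t ^ x) A

/-- Logarithm of a positive semidefinite matrix taken on its support
(`Real.log 0 = 0` in Mathlib, matching the convention `log̃ 0 = 0`). -/
noncomputable def matLog (A : Matrix ι ι ℂ) : Matrix ι ι ℂ :=
  hermApply Real.log A

/-- `supp ρ ≤ supp σ`, expressed (for PSD matrices) as inclusion of kernels. -/
def suppLE (ρ σ : Matrix ι ι ℂ) : Prop :=
  ∀ v : ι → ℂ, σ.mulVec v = 0 → ρ.mulVec v = 0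

/-- The Loewner (positive semidefinite) order. -/
def loewnerLE (A B : Matrix ι ι ℂ) : Prop := (B - A).PosSemidef

/-- Real part of the trace. -/
noncomputable def reTrace (A : Matrix ι ι ℂ) : ℝ := A.trace.re

/-- The trace quantity `Tr ((σ^{(1-α)/(2z)} ρ^{α/z} σ^{(1-α)/(2z)})^z)` (a real number). -/
noncomputable def Qaz (α z : ℝ) (ρ σ : Matrix ι ι ℂ) : ℝ :=
  reTrace (matPow (matPow σ ((1 - α) / (2 * z)) * matPow ρ (α / z) *
    matPow σ ((1 - α) / (2 * z))) z)

/-- The Rényi `(α,z)`-divergence (for `α ≠ 1`), with values in `EReal = ℝ ∪ {±∞}`.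
It equals `(α-1)⁻¹ (log Q_{α,z}(ρ‖σ) - log Tr ρ)`; it is `+∞` when `α > 1` and
`supp ρ ≰ supp σ`, and also `+∞` when `α < 1` and `Q_{α,z}(ρ‖σ) = 0`
(i.e. `(α-1)⁻¹ log 0 = +∞`). -/
noncomputable def Daz (α z : ℝ) (ρ σ : Matrix ι ι ℂ) : EReal :=
  if (suppLE ρ σ ∨ α < 1) ∧ Qaz α z ρ σ ≠ 0 then
    (((α - 1)⁻¹ * (Real.log (Qaz α z ρ σ) - Real.log (reTrace ρ)) : ℝ) : EReal)
  else ⊤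

/-- The (normalized) Umegaki relative entropy. -/
noncomputable def DUm (ρ σ : Matrix ι ι ℂ) : EReal :=
  if suppLE ρ σ then
    (((reTrace ρ)⁻¹ * reTrace (ρ * (matLog ρ - matLog σ)) : ℝ) : EReal)
  else ⊤

/-- The Rényi `(α,z)`-divergence, with `D_{1,z} := D^Um`. -/
noncomputable def Dfull (α z : ℝ) (ρ σ : Matrix ι ι ℂ) : EReal :=
  if α = 1 then DUm ρ σ else Daz α z ρ σ

/-- The max-relative entropy `D_max(ρ‖σ) = log inf {λ > 0 : ρ ≤ λ σ}`. -/
noncomputable def Dmax (ρ σ : Matrix ι ι ℂ) : EReal :=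
  if ∃ c : ℝ, 0 < c ∧ loewnerLE ρ (c • σ) then
    ((Real.log (sInf {c : ℝ | 0 < c ∧ loewnerLE ρ (c • σ)}) : ℝ) : EReal)
  else ⊤

/-- The classical quantity `Q_α^cl(ρ‖σ) = ∑_x ρ(x)^α σ(x)^{1-α}` (with `0^t = 0` for `t ≠ 0`). -/
noncomputable def Qcl {X : Type*} [Fintype X] (α : ℝ) (ρ σ : X → ℝ) : ℝ :=
  ∑ x, ρ x ^ α * σ x ^ (1 - α)

/-- Absolute continuity `ρ ≪ σ` for functions on a finite set. -/
def acl {X : Type*} (ρ σ : X → ℝ) : Prop := ∀ x, σ x = 0 → ρ x = 0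

/-- The classical Rényi `α`-divergence, with values in `EReal`; for `α = 1` it is the
(normalized) Kullback-Leibler divergence. -/
noncomputable def Dcl {X : Type*} [Fintype X] (α : ℝ) (ρ σ : X → ℝ) : EReal :=
  if α = 1 then
    (if acl ρ σ then
      ((((∑ x, ρ x)⁻¹ * ∑ x, ρ x * (Real.log (ρ x) - Real.log (σ x))) : ℝ) : EReal)
     else ⊤)
  else if (acl ρ σ ∨ α < 1) ∧ Qcl α ρ σ ≠ 0 then
    ((((α - 1)⁻¹ * (Real.log (Qcl α ρ σ) - Real.log (∑ x, ρ x))) : ℝ) : EReal)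
  else ⊤

/-- The measured Rényi `α`-divergence: supremum over all finite-outcome POVMs. -/
noncomputable def Dmeas (α : ℝ) (ρ σ : Matrix ι ι ℂ) : EReal :=
  ⨆ (k : ℕ) (M : Fin k → Matrix ι ι ℂ)
    (_ : (∀ i, (M i).PosSemidef) ∧ ∑ i, M i = 1),
    Dcl α (fun i => reTrace (M i * ρ)) (fun i => reTrace (M i * σ))

/-- A `κ`-function: a continuous nonnegative function on `[0,∞)` with
`limsup_{x→0⁺} f(x) x^{-κ} < ∞`. -/
def IsKappaFunction (κ : ℝ) (f : ℝ → ℝ) : Prop :=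
  ContinuousOn f (Set.Ici 0) ∧ (∀ x ∈ Set.Ici (0 : ℝ), 0 ≤ f x) ∧
    ∃ M : ℝ, ∀ᶠ x in 𝓝[>] (0 : ℝ), f x ≤ M * x ^ κ

/-- A strict `κ`-function: a `κ`-function with `liminf_{x→0⁺} f(x) x^{-κ} > 0`. -/
def IsStrictKappaFunction (κ : ℝ) (f : ℝ → ℝ) : Prop :=
  IsKappaFunction κ f ∧ ∃ c : ℝ, 0 < c ∧ ∀ᶠ x in 𝓝[>] (0 : ℝ), c * x ^ κ ≤ f x

/-- Nonzero PSD matrix predicate. -/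
def PSDne (A : Matrix ι ι ℂ) : Prop := A.PosSemidef ∧ A ≠ 0

section Matrices

open Matrix
open scoped MatrixOrder Matrix.Norms.L2Operator

lemma continuousOn_spectrum (f : ℝ → ℝ) (A : Matrix ι ι ℂ) :
    ContinuousOn f (spectrum ℝ A) :=
  A.finite_real_spectrum.continuousOn f

lemma hermApply_eq_cfc (f : ℝ → ℝ) (A : Matrix ι ι ℂ) : hermApply f A = cfc f A := by
  unfold hermApply
  split_ifs with h
  · exact (h.cfc_eq f).symm
  · exact (cfc_apply_of_not_predicate A h).symm

/-- Real powers with the convention that `0` is mapped to `0`. -/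
def suppPow (x t : ℝ) : ℝ := if t = 0 then 0 else t ^ x

lemma suppPow_zero_right (x : ℝ) : suppPow x 0 = 0 := by simp [suppPow]

lemma suppPow_one_right (x : ℝ) : suppPow x 1 = 1 := by simp [suppPow]

lemma suppPow_of_ne_zero {x t : ℝ} (ht : t ≠ 0) : suppPow x t = t ^ x := by simp [suppPow, ht]

lemma suppPow_of_pos {x : ℝ} (hx : 0 < x) (t : ℝ) : suppPow x t = t ^ x := by
  unfold suppPow
  split_ifs with h
  · rw [h, Real.zero_rpow hx.ne']
  · rfl

lemma suppPow_nonneg (x : ℝ) {t : ℝ} (ht : 0 ≤ t) : 0 ≤ suppPow x t := by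
  unfold suppPow
  split_ifs
  · exact le_rfl
  · positivity

lemma matPow_eq_cfc (A : Matrix ι ι ℂ) (x : ℝ) : matPow A x = cfc (suppPow x) A :=
  hermApply_eq_cfc _ A

lemma matLog_eq_cfc (A : Matrix ι ι ℂ) : matLog A = cfc Real.log A :=
  hermApply_eq_cfc _ A

lemma isHermitian_cfc (f : ℝ → ℝ) (A : Matrix ι ι ℂ) : (cfc f A).IsHermitian :=
  cfc_predicate f A

lemma nonneg_of_mem_spectrum {A : Matrix ι ι ℂ} (hA : A.PosSemidef) {x : ℝ}
    (hx : x ∈ spectrum ℝ A) : 0 ≤ x :=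
  spectrum_nonneg_of_nonneg (nonneg_iff_posSemidef.2 hA) hx

lemma posSemidef_cfc {f : ℝ → ℝ} {A : Matrix ι ι ℂ} (h : ∀ x ∈ spectrum ℝ A, 0 ≤ f x) :
    (cfc f A).PosSemidef :=
  nonneg_iff_posSemidef.1 (cfc_nonneg h)

lemma posSemidef_matPow {A : Matrix ι ι ℂ} (hA : A.PosSemidef) (x : ℝ) :
    (matPow A x).PosSemidef := by
  rw [matPow_eq_cfc]
  exact posSemidef_cfc fun t ht => suppPow_nonneg x (nonneg_of_mem_spectrum hA ht)

lemma matPow_mul_matPow {A : Matrix ι ι ℂ} (hA : A.PosSemidef) (x y : ℝ) :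
    matPow A x * matPow A y = matPow A (x + y) := by
  simp only [matPow_eq_cfc]
  rw [← cfc_mul _ _ A (continuousOn_spectrum _ A) (continuousOn_spectrum _ A)]
  refine cfc_congr fun t ht => ?_
  unfold suppPow
  split_ifs with h
  · simp
  · rw [Real.rpow_add (lt_of_le_of_ne (nonneg_of_mem_spectrum hA ht) (Ne.symm h))]

lemma matPow_one {A : Matrix ι ι ℂ} (hA : A.IsHermitian) : matPow A 1 = A := by
  rw [matPow_eq_cfc]
  refine (cfc_congr fun t _ => ?_).trans (cfc_id ℝ A hA)
  simp [suppPow_of_pos one_pos]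

lemma cfc_matPow {A : Matrix ι ι ℂ} (hA : A.PosSemidef) (f : ℝ → ℝ) (x : ℝ) :
    cfc f (matPow A x) = cfc (fun t => f (suppPow x t)) A := by
  rw [matPow_eq_cfc]
  exact (cfc_comp' f (suppPow x) A
    ((A.finite_real_spectrum.image _).continuousOn f) (continuousOn_spectrum _ A) hA.1).symm

lemma suppPow_suppPow {t : ℝ} (ht : 0 ≤ t) (x y : ℝ) :
    suppPow y (suppPow x t) = suppPow (x * y) t := by
  rcases ht.eq_or_lt with rfl | h
  · simp [suppPow_zero_right]
  · rw [suppPow_of_ne_zero h.ne', suppPow_of_ne_zero h.ne',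
      suppPow_of_ne_zero (Real.rpow_pos_of_pos h x).ne', Real.rpow_mul h.le]

lemma matPow_matPow {A : Matrix ι ι ℂ} (hA : A.PosSemidef) (x y : ℝ) :
    matPow (matPow A x) y = matPow A (x * y) := by
  rw [matPow_eq_cfc (matPow A x), cfc_matPow hA, matPow_eq_cfc]
  exact cfc_congr fun t ht => suppPow_suppPow (nonneg_of_mem_spectrum hA ht) x y

lemma matLog_matPow {A : Matrix ι ι ℂ} (hA : A.PosSemidef) (x : ℝ) :
    matLog (matPow A x) = x • matLog A := by
  rw [matLog_eq_cfc, matLog_eq_cfc, cfc_matPow hA, ← cfc_smul x _ A (continuousOn_spectrum _ A)]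
  refine cfc_congr fun t ht => ?_
  rcases (nonneg_of_mem_spectrum hA ht).eq_or_lt with rfl | h
  · simp [suppPow_zero_right]
  · simp [suppPow_of_ne_zero h.ne', Real.log_rpow h]

/-- The orthogonal projection onto the kernel of a positive semidefinite matrix. -/
def kerProj (A : Matrix ι ι ℂ) : Matrix ι ι ℂ := 1 - matPow A 0

lemma isHermitian_matPow (A : Matrix ι ι ℂ) (x : ℝ) : (matPow A x).IsHermitian := by
  rw [matPow_eq_cfc]; exact isHermitian_cfc _ _

lemma isHermitian_kerProj (A : Matrix ι ι ℂ) : (kerProj A).IsHermitian :=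
  isHermitian_one.sub (isHermitian_matPow A 0)

lemma matPow_mul_kerProj {A : Matrix ι ι ℂ} (hA : A.PosSemidef) (x : ℝ) :
    matPow A x * kerProj A = 0 := by
  rw [kerProj, mul_sub, mul_one, matPow_mul_matPow hA, add_zero, sub_self]

lemma mul_kerProj {A : Matrix ι ι ℂ} (hA : A.PosSemidef) : A * kerProj A = 0 := by
  simpa [matPow_one hA.1] using matPow_mul_kerProj hA 1

lemma kerProj_mul_self {A : Matrix ι ι ℂ} (hA : A.PosSemidef) :
    kerProj A * kerProj A = kerProj A := by
  nth_rw 1 [kerProj]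
  rw [sub_mul, matPow_mul_kerProj hA, one_mul, sub_zero]

lemma posSemidef_kerProj {A : Matrix ι ι ℂ} (hA : A.PosSemidef) : (kerProj A).PosSemidef := by
  have h := posSemidef_conjTranspose_mul_self (kerProj A)
  rwa [(isHermitian_kerProj A).eq, kerProj_mul_self hA] at h

/-- Polynomial evaluation on a sum of two orthogonal matrices, the second one being a multiple of
a projection. -/
lemma aeval_add_smul_of_mul_eq_zero {S R : Matrix ι ι ℂ} (hRR : R * R = R) (hSR : S * R = 0)
    (hRS : R * S = 0) (ε : ℝ) (p : Polynomial ℝ) :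
    Polynomial.aeval (S + ε • R) p =
      Polynomial.aeval S p + (p.eval ε - p.eval 0) • R := by
  induction p using Polynomial.induction_on with
  | C a => simp
  | add p q hp hq => simp only [map_add, hp, hq, Polynomial.eval_add]; module
  | monomial k a _ =>
    have key : ∀ k : ℕ, (S + ε • R) ^ (k + 1) = S ^ (k + 1) + ε ^ (k + 1) • R := by
      intro k
      induction k with
      | zero => simp
      | succ k ih =>
        rw [pow_succ, ih, add_mul, mul_add, mul_add, pow_succ S k, mul_assoc (S ^ k) S (ε • R),
          mul_smul_comm, hSR, smul_mul_assoc, hRS, smul_mul_smul_comm, hRR]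
        simp [pow_succ]
    simp only [map_mul, Polynomial.aeval_C, map_pow, Polynomial.aeval_X, key,
      Polynomial.eval_mul, Polynomial.eval_C, Polynomial.eval_pow, Polynomial.eval_X]
    simp only [Algebra.algebraMap_eq_smul_one, smul_mul_assoc, one_mul]
    simp only [ne_eq, Nat.add_eq_zero_iff, one_ne_zero, and_false, not_false_eq_true, zero_pow]
    module

lemma cfc_eq_aeval {f : ℝ → ℝ} {A : Matrix ι ι ℂ} (hA : A.IsHermitian) (p : Polynomial ℝ)
    (h : ∀ x ∈ spectrum ℝ A, p.eval x = f x) : cfc f A = Polynomial.aeval A p := by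
  rw [← cfc_polynomial p A hA]
  exact cfc_congr fun x hx => (h x hx).symm

lemma exists_polynomial_eval_eq (f : ℝ → ℝ) {s : Set ℝ} (hs : s.Finite) :
    ∃ p : Polynomial ℝ, ∀ x ∈ s, p.eval x = f x :=
  ⟨Lagrange.interpolate hs.toFinset id f, fun _ hx =>
    Lagrange.eval_interpolate_at_node f (Set.injOn_id _) (hs.mem_toFinset.2 hx)⟩

lemma cfc_add_smul_of_mul_eq_zero {S R : Matrix ι ι ℂ} (hS : S.IsHermitian) (hR : R.IsHermitian)
    (hRR : R * R = R) (hSR : S * R = 0) (ε : ℝ) {f : ℝ → ℝ} (hf : f 0 = 0) :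
    cfc f (S + ε • R) = cfc f S + f ε • R := by
  have hRS : R * S = 0 := by
    have := congrArg conjTranspose hSR
    rwa [conjTranspose_mul, hS.eq, hR.eq, conjTranspose_zero] at this
  have hT : (S + ε • R).IsHermitian := by
    refine hS.add ?_
    unfold Matrix.IsHermitian
    rw [conjTranspose_smul, hR.eq, star_trivial]
  obtain ⟨p, hp⟩ := exists_polynomial_eval_eq f
    (((S.finite_real_spectrum.union (S + ε • R).finite_real_spectrum).insert 0).insert ε)
  have h0 : p.eval 0 = f 0 := hp 0 (by simp)
  have hε : p.eval ε = f ε := hp ε (by simp)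
  rw [cfc_eq_aeval hT p fun x hx => hp x (by simp [hx]),
    cfc_eq_aeval hS p fun x hx => hp x (by simp [hx]),
    aeval_add_smul_of_mul_eq_zero hRR hSR hRS, h0, hε, hf, sub_zero]

lemma cfc_add_of_mul_eq_zero {S R : Matrix ι ι ℂ} (hS : S.IsHermitian) (hR : R.IsHermitian)
    (hRR : R * R = R) (hSR : S * R = 0) {f : ℝ → ℝ} (hf : f 0 = 0) :
    cfc f (S + R) = cfc f S + f 1 • R := by
  simpa using cfc_add_smul_of_mul_eq_zero hS hR hRR hSR 1 hf

lemma matPow_add_of_mul_eq_zero {S R : Matrix ι ι ℂ} (hS : S.IsHermitian) (hR : R.IsHermitian)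
    (hRR : R * R = R) (hSR : S * R = 0) (x : ℝ) :
    matPow (S + R) x = matPow S x + R := by
  rw [matPow_eq_cfc, matPow_eq_cfc,
    cfc_add_of_mul_eq_zero hS hR hRR hSR (suppPow_zero_right x), suppPow_one_right, one_smul]

lemma matLog_add_of_mul_eq_zero {S R : Matrix ι ι ℂ} (hS : S.IsHermitian) (hR : R.IsHermitian)
    (hRR : R * R = R) (hSR : S * R = 0) : matLog (S + R) = matLog S := by
  rw [matLog_eq_cfc, matLog_eq_cfc, cfc_add_of_mul_eq_zero hS hR hRR hSR Real.log_zero,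
    Real.log_one, zero_smul, add_zero]

lemma trace_cfc {A : Matrix ι ι ℂ} (hA : A.IsHermitian) (f : ℝ → ℝ) :
    reTrace (cfc f A) = (A.charpoly.roots.map fun x => f x.re).sum := by
  rw [hA.roots_charpoly_eq_eigenvalues, hA.cfc_eq, IsHermitian.cfc, reTrace,
    Unitary.conjStarAlgAut_apply, Matrix.trace_mul_comm, ← mul_assoc,
    Unitary.coe_star_mul_self, one_mul, Matrix.trace_diagonal, Multiset.map_map, Complex.re_sum]
  rfl

lemma trace_cfc_mul_conjTranspose_comm (M : Matrix ι ι ℂ) (f : ℝ → ℝ) :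
    reTrace (cfc f (M * Mᴴ)) = reTrace (cfc f (Mᴴ * M)) := by
  rw [trace_cfc (isHermitian_mul_conjTranspose_self M),
    trace_cfc (isHermitian_conjTranspose_mul_self M), charpoly_mul_comm]

lemma exists_trace_cfc_mul_cfc {A B : Matrix ι ι ℂ} (hA : A.IsHermitian) (hB : B.IsHermitian) :
    ∃ w : ι → ι → ℝ, (∀ i j, 0 ≤ w i j) ∧ ∀ f g : ℝ → ℝ,
      reTrace (cfc f A * cfc g B) =
        ∑ i, ∑ j, w i j * (f (hA.eigenvalues i) * g (hB.eigenvalues j)) := by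
  set U : Matrix ι ι ℂ := ↑hA.eigenvectorUnitary
  set V : Matrix ι ι ℂ := ↑hB.eigenvectorUnitary
  refine ⟨fun i j => Complex.normSq ((star U * V) i j), fun i j => Complex.normSq_nonneg _,
    fun f g => ?_⟩
  have h : (cfc f A * cfc g B).trace =
      (Matrix.diagonal (RCLike.ofReal ∘ f ∘ hA.eigenvalues) * (star U * V) *
        Matrix.diagonal (RCLike.ofReal ∘ g ∘ hB.eigenvalues) * star (star U * V)).trace := by
    rw [hA.cfc_eq, hB.cfc_eq, IsHermitian.cfc, IsHermitian.cfc,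
      Unitary.conjStarAlgAut_apply, Unitary.conjStarAlgAut_apply, star_mul, star_star]
    simp only [mul_assoc]
    rw [Matrix.trace_mul_comm]
    simp only [mul_assoc, U, V]
  rw [reTrace, h]
  simp only [Matrix.trace, Matrix.diag, Matrix.mul_apply (M := _ * Matrix.diagonal _),
    Matrix.mul_diagonal, Matrix.diagonal_mul, Complex.re_sum, Matrix.star_apply]
  refine Finset.sum_congr rfl fun i _ => Finset.sum_congr rfl fun j _ => ?_
  simp [Complex.normSq_apply]
  ring

lemma trace_add_trace_mul_sub_le {A B : Matrix ι ι ℂ} (hA : A.IsHermitian) (hB : B.IsHermitian)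
    {f k : ℝ → ℝ} (h : ∀ a ∈ spectrum ℝ A, ∀ b ∈ spectrum ℝ B, f a + k a * (b - a) ≤ f b) :
    reTrace (cfc f A) + reTrace (cfc k A * (B - A)) ≤ reTrace (cfc f B) := by
  obtain ⟨w, hw, hwt⟩ := exists_trace_cfc_mul_cfc hA hB
  have h1 : reTrace (cfc f A) = ∑ i, ∑ j, w i j * f (hA.eigenvalues i) := by
    simpa [cfc_const_one ℝ B hB.isSelfAdjoint] using hwt f fun _ => 1
  have h2 : reTrace (cfc f B) = ∑ i, ∑ j, w i j * f (hB.eigenvalues j) := by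
    simpa [cfc_const_one ℝ A hA.isSelfAdjoint] using hwt (fun _ => 1) f
  have h3 : reTrace (cfc k A * B) =
      ∑ i, ∑ j, w i j * (k (hA.eigenvalues i) * hB.eigenvalues j) := by
    simpa [cfc_id ℝ B hB.isSelfAdjoint] using hwt k id
  have h4 : reTrace (cfc k A * A) =
      ∑ i, ∑ j, w i j * (k (hA.eigenvalues i) * hA.eigenvalues i) := by
    have := hwt (fun t => k t * t) fun _ => 1
    rw [cfc_mul k (fun t => t) A (continuousOn_spectrum _ A) (continuousOn_spectrum _ A),
      cfc_id' ℝ A hA.isSelfAdjoint, cfc_const_one ℝ B hB.isSelfAdjoint] at this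
    simpa using this
  have h5 : reTrace (cfc k A * (B - A)) = reTrace (cfc k A * B) - reTrace (cfc k A * A) := by
    simp [reTrace, mul_sub]
  rw [h5, h1, h2, h3, h4, ← Finset.sum_sub_distrib, ← Finset.sum_add_distrib]
  refine Finset.sum_le_sum fun i _ => ?_
  rw [← Finset.sum_sub_distrib, ← Finset.sum_add_distrib]
  refine Finset.sum_le_sum fun j _ => ?_
  have := mul_le_mul_of_nonneg_left (h _ (hA.eigenvalues_mem_spectrum_real i) _
    (hB.eigenvalues_mem_spectrum_real j)) (hw i j)
  linarith

lemma rpow_tangent_le {a b z : ℝ} (ha : 0 < a) (hb : 0 ≤ b) (hz : 1 ≤ z) :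
    a ^ z + z * a ^ (z - 1) * (b - a) ≤ b ^ z := by
  have h := one_add_mul_self_le_rpow_one_add (s := b / a - 1)
    (by linarith [div_nonneg hb ha.le]) hz
  rw [add_sub_cancel, Real.div_rpow hb ha.le, le_div_iff₀ (by positivity)] at h
  refine le_trans (le_of_eq ?_) h
  rw [Real.rpow_sub_one ha.ne']
  field_simp

lemma le_rpow_tangent {a b z : ℝ} (ha : 0 < a) (hb : 0 ≤ b) (hz0 : 0 ≤ z) (hz : z ≤ 1) :
    b ^ z ≤ a ^ z + z * a ^ (z - 1) * (b - a) := by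
  have h := rpow_one_add_le_one_add_mul_self (s := b / a - 1)
    (by linarith [div_nonneg hb ha.le]) hz0 hz
  rw [add_sub_cancel, Real.div_rpow hb ha.le, div_le_iff₀ (by positivity)] at h
  refine h.trans (le_of_eq ?_)
  rw [Real.rpow_sub_one ha.ne']
  field_simp

lemma pos_of_mem_spectrum {A : Matrix ι ι ℂ} (hA : A.PosDef) {x : ℝ}
    (hx : x ∈ spectrum ℝ A) : 0 < x := by
  rw [hA.1.spectrum_real_eq_range_eigenvalues] at hx
  obtain ⟨i, rfl⟩ := hx
  exact hA.eigenvalues_pos i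

lemma reTrace_smul (r : ℝ) (A : Matrix ι ι ℂ) : reTrace (r • A) = r * reTrace A := by
  simp [reTrace]

lemma reTrace_add (A B : Matrix ι ι ℂ) : reTrace (A + B) = reTrace A + reTrace B := by
  simp [reTrace]

lemma reTrace_sub (A B : Matrix ι ι ℂ) : reTrace (A - B) = reTrace A - reTrace B := by
  simp [reTrace]

lemma reTrace_mul_comm (A B : Matrix ι ι ℂ) : reTrace (A * B) = reTrace (B * A) := by
  rw [reTrace, Matrix.trace_mul_comm, reTrace]

lemma smul_matPow_eq_cfc (A : Matrix ι ι ℂ) (c x : ℝ) :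
    c • matPow A x = cfc (fun t => c * suppPow x t) A := by
  rw [matPow_eq_cfc, ← cfc_smul c _ A (continuousOn_spectrum _ A)]
  rfl

lemma trace_matPow_tangent_le {A B : Matrix ι ι ℂ} (hA : A.PosSemidef) (hB : B.PosSemidef)
    {z : ℝ} (hz : 1 ≤ z) :
    reTrace (matPow A z) + z * reTrace (matPow A (z - 1) * (B - A)) ≤ reTrace (matPow B z) := by
  rw [← reTrace_smul, ← smul_mul_assoc, smul_matPow_eq_cfc, matPow_eq_cfc, matPow_eq_cfc]
  refine trace_add_trace_mul_sub_le hA.1 hB.1 fun a ha b hb => ?_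
  have hb' := nonneg_of_mem_spectrum hB hb
  rcases (nonneg_of_mem_spectrum hA ha).eq_or_lt with rfl | h
  · simpa [suppPow_zero_right] using suppPow_nonneg z hb'
  · rw [suppPow_of_ne_zero h.ne', suppPow_of_ne_zero h.ne', suppPow_of_pos (by linarith : 0 < z) b]
    exact rpow_tangent_le h hb' hz

lemma le_trace_matPow_tangent {A B : Matrix ι ι ℂ} (hA : A.PosDef) (hB : B.PosSemidef)
    {z : ℝ} (hz0 : 0 < z) (hz : z ≤ 1) :
    reTrace (matPow B z) ≤ reTrace (matPow A z) + z * reTrace (matPow A (z - 1) * (B - A)) := by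
  have key := trace_add_trace_mul_sub_le (f := fun t => (-1) * suppPow z t)
    (k := fun t => (-z) * suppPow (z - 1) t) hA.1 hB.1 fun a ha b hb => by
      have h := pos_of_mem_spectrum hA ha
      have := le_rpow_tangent h (nonneg_of_mem_spectrum hB hb) hz0.le hz
      rw [suppPow_of_pos hz0, suppPow_of_pos hz0, suppPow_of_ne_zero h.ne']
      linarith
  simp only [← smul_matPow_eq_cfc, smul_mul_assoc, reTrace_smul] at key
  linarith

lemma trace_mul_nonneg {A B : Matrix ι ι ℂ} (hA : A.PosSemidef) (hB : B.PosSemidef) :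
    0 ≤ reTrace (A * B) := by
  have h := (isHermitian_matPow A (1 / 2)).eq
  have e : matPow A (1 / 2) * matPow A (1 / 2) = A := by
    rw [matPow_mul_matPow hA, add_halves, matPow_one hA.1]
  have := (hB.mul_mul_conjTranspose_same (matPow A (1 / 2))).trace_nonneg
  rw [h] at this
  rw [← e, mul_assoc, reTrace_mul_comm, reTrace]
  exact (Complex.le_def.1 this).1

lemma trace_matPow_le {A B : Matrix ι ι ℂ} (hA : A.PosSemidef) (hB : B.PosDef) (hAB : A ≤ B)
    {z : ℝ} (hz : 0 < z) : reTrace (matPow A z) ≤ reTrace (matPow B z) := by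
  rcases le_total 1 z with h | h
  · have h1 := trace_matPow_tangent_le hA hB.posSemidef h
    have h2 := trace_mul_nonneg (posSemidef_matPow hA (z - 1)) hAB
    nlinarith
  · have h1 := le_trace_matPow_tangent hB hA hz h
    have h2 := trace_mul_nonneg (posSemidef_matPow hB.posSemidef (z - 1)) hAB
    rw [← neg_sub B A, mul_neg] at h1
    have h3 : reTrace (-(matPow B (z - 1) * (B - A))) = - reTrace (matPow B (z - 1) * (B - A)) := by
      simp [reTrace]
    rw [h3] at h1
    nlinarith

/-- Second-order remainder of the trace of a power. -/
lemma abs_trace_matPow_sub_le {A B : Matrix ι ι ℂ} (hA : A.PosDef) (hB : B.PosDef)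
    {z : ℝ} (hz : 0 < z) :
    |reTrace (matPow B z) - reTrace (matPow A z) - z * reTrace (matPow A (z - 1) * (B - A))| ≤
      |z * reTrace ((matPow B (z - 1) - matPow A (z - 1)) * (B - A))| := by
  have e : reTrace (matPow B (z - 1) * (A - B)) = - reTrace (matPow B (z - 1) * (B - A)) := by
    rw [← neg_sub B A, mul_neg]; simp [reTrace]
  have e2 : reTrace ((matPow B (z - 1) - matPow A (z - 1)) * (B - A)) =
      reTrace (matPow B (z - 1) * (B - A)) - reTrace (matPow A (z - 1) * (B - A)) := by
    rw [sub_mul, reTrace_sub]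
  rw [e2]
  rcases le_total 1 z with h | h
  · have h1 := trace_matPow_tangent_le hA.posSemidef hB.posSemidef h
    have h2 := trace_matPow_tangent_le hB.posSemidef hA.posSemidef h
    rw [e] at h2
    refine abs_le_abs (by linarith) (by linarith)
  · have h1 := le_trace_matPow_tangent hA hB.posSemidef hz h
    have h2 := le_trace_matPow_tangent hB hA.posSemidef hz h
    rw [e] at h2
    rw [← abs_neg, ← abs_neg (z * _)]
    refine abs_le_abs (by linarith) (by linarith)

lemma norm_le_of_neg_le_of_le {A : Matrix ι ι ℂ} (hA : A.IsHermitian) {δ : ℝ} (hδ : 0 ≤ δ)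
    (h1 : -(algebraMap ℝ _ δ) ≤ A) (h2 : A ≤ algebraMap ℝ _ δ) : ‖A‖ ≤ δ := by
  cases subsingleton_or_nontrivial (Matrix ι ι ℂ)
  · rwa [Subsingleton.elim A 0, norm_zero]
  rw [← map_neg] at h1
  rcases CStarAlgebra.norm_or_neg_norm_mem_spectrum (a := A) hA.isSelfAdjoint with h | h
  · exact (le_algebraMap_iff_spectrum_le (ha := hA.isSelfAdjoint)).1 h2 _ h
  · linarith [(algebraMap_le_iff_le_spectrum (ha := hA.isSelfAdjoint)).1 h1 _ h]

lemma norm_matLog_sub_le {A X : Matrix ι ι ℂ} (hA : A.PosDef) (hX : X.PosDef) {δ : ℝ}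
    (hδ : 0 ≤ δ) (h1 : Real.exp (-δ) • A ≤ X) (h2 : X ≤ Real.exp δ • A) :
    ‖matLog X - matLog A‖ ≤ δ := by
  have hA' := isStrictlyPositive_iff_posDef.2 hA
  have hX' := isStrictlyPositive_iff_posDef.2 hX
  have hs : ∀ r : ℝ, IsStrictlyPositive (Real.exp r • A) := fun r =>
    isStrictlyPositive_iff_posDef.2 (hA.smul (Real.exp_pos r))
  have l1 := CFC.log_le_log h1 (hs _)
  have l2 := CFC.log_le_log h2 hX'
  rw [CFC.log_smul' A (Real.exp_pos _) hA', Real.log_exp] at l1 l2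
  rw [matLog_eq_cfc, matLog_eq_cfc]
  change ‖CFC.log X - CFC.log A‖ ≤ δ
  refine norm_le_of_neg_le_of_le (IsSelfAdjoint.log.sub IsSelfAdjoint.log).isHermitian hδ ?_ ?_
  · rw [map_neg] at l1
    exact le_sub_iff_add_le.2 l1
  · exact sub_le_iff_le_add.2 l2

lemma matPow_eq_exp {A : Matrix ι ι ℂ} (hA : A.PosDef) (x : ℝ) :
    matPow A x = NormedSpace.exp (x • matLog A) := by
  have hS : IsSelfAdjoint (cfc (fun t => x • Real.log t) A) := isHermitian_cfc _ A
  rw [matLog_eq_cfc, ← cfc_smul x _ A (continuousOn_spectrum _ A),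
    ← CFC.real_exp_eq_normedSpace_exp hS, matPow_eq_cfc,
    ← cfc_comp' Real.exp (fun t => x • Real.log t) A
    ((A.finite_real_spectrum.image _).continuousOn _) (continuousOn_spectrum _ A)
    hA.1.isSelfAdjoint]
  refine cfc_congr fun t ht => ?_
  have := pos_of_mem_spectrum hA ht
  simp only [suppPow_of_ne_zero this.ne', Real.rpow_def_of_pos this, smul_eq_mul, mul_comm x]

lemma tendsto_exp_sub_exp {β : Type*} {l : Filter β} {K L : β → Matrix ι ι ℂ} {C : ℝ}
    (h : Tendsto (fun b => K b - L b) l (𝓝 0)) (hL : ∀ᶠ b in l, ‖L b‖ ≤ C) :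
    Tendsto (fun b => NormedSpace.exp (K b) - NormedSpace.exp (L b)) l (𝓝 0) := by
  have : ProperSpace (Matrix ι ι ℂ) := FiniteDimensional.proper ℂ _
  let +nondep : NormedAlgebra ℚ (Matrix ι ι ℂ) := .restrictScalars ℚ ℂ _
  have hu : UniformContinuousOn (NormedSpace.exp : Matrix ι ι ℂ → Matrix ι ι ℂ)
      (Metric.closedBall 0 (C + 1)) :=
    (isCompact_closedBall _ _).uniformContinuousOn_of_continuous
      (NormedSpace.exp_continuous).continuousOn
  rw [Metric.uniformContinuousOn_iff] at hu
  rw [Metric.tendsto_nhds] at h ⊢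
  intro ε hε
  obtain ⟨δ, hδ, H⟩ := hu ε hε
  filter_upwards [h δ hδ, h 1 one_pos, hL] with b h1 h2 h3
  rw [dist_zero_right] at h1 h2 ⊢
  rw [← dist_eq_norm]
  refine H _ ?_ _ ?_ (by rwa [dist_eq_norm])
  · rw [mem_closedBall_zero_iff]
    have := norm_add_le (K b - L b) (L b)
    rw [sub_add_cancel] at this
    linarith
  · rw [mem_closedBall_zero_iff]; linarith

lemma posDef_cfc {f : ℝ → ℝ} {A : Matrix ι ι ℂ} (hA : A.IsHermitian)
    (h : ∀ x ∈ spectrum ℝ A, 0 < f x) : (cfc f A).PosDef := by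
  refine (posSemidef_cfc fun x hx => (h x hx).le).posDef_iff_isUnit.2 ?_
  refine IsUnit.of_mul_eq_one (cfc (fun t => (f t)⁻¹) A) ?_
  rw [← cfc_mul f (fun t => (f t)⁻¹) A (continuousOn_spectrum _ A) (continuousOn_spectrum _ A),
    ← cfc_const_one ℝ A hA.isSelfAdjoint]
  exact cfc_congr fun x hx => mul_inv_cancel₀ (h x hx).ne'

lemma kerProj_eq_cfc {A : Matrix ι ι ℂ} (hA : A.IsHermitian) :
    kerProj A = cfc (fun t => 1 - suppPow 0 t) A := by
  rw [kerProj, matPow_eq_cfc, cfc_sub (fun _ => 1) (suppPow 0) A (continuousOn_spectrum _ A)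
    (continuousOn_spectrum _ A), cfc_const_one ℝ A hA.isSelfAdjoint]

lemma matPow_add_smul_kerProj_eq_cfc {A : Matrix ι ι ℂ} (hA : A.IsHermitian) (x ε : ℝ) :
    matPow A x + ε • kerProj A = cfc (fun t => suppPow x t + ε * (1 - suppPow 0 t)) A := by
  rw [kerProj_eq_cfc hA, matPow_eq_cfc, ← cfc_const_mul ε _ A (continuousOn_spectrum _ A),
    ← cfc_add A _ _ (continuousOn_spectrum _ A) (continuousOn_spectrum _ A)]

lemma posDef_matPow_add_smul_kerProj {A : Matrix ι ι ℂ} (hA : A.PosSemidef) (x : ℝ) {ε : ℝ}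
    (hε : 0 < ε) : (matPow A x + ε • kerProj A).PosDef := by
  rw [matPow_add_smul_kerProj_eq_cfc hA.1]
  refine posDef_cfc hA.1 fun t ht => ?_
  rcases (nonneg_of_mem_spectrum hA ht).eq_or_lt with rfl | h
  · simpa [suppPow_zero_right] using hε
  · simpa [suppPow_of_ne_zero h.ne'] using Real.rpow_pos_of_pos h x

lemma posDef_matPow_add_kerProj {A : Matrix ι ι ℂ} (hA : A.PosSemidef) (x : ℝ) :
    (matPow A x + kerProj A).PosDef := by
  simpa using posDef_matPow_add_smul_kerProj hA x one_pos

lemma posDef_add_smul_kerProj {A : Matrix ι ι ℂ} (hA : A.PosSemidef) {ε : ℝ} (hε : 0 < ε) :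
    (A + ε • kerProj A).PosDef := by
  simpa [matPow_one hA.1] using posDef_matPow_add_smul_kerProj hA 1 hε

lemma tendsto_cfc_of_pointwise {β : Type*} {l : Filter β} {F : β → ℝ → ℝ} {f : ℝ → ℝ}
    {A : Matrix ι ι ℂ} (h : ∀ t ∈ spectrum ℝ A, Tendsto (fun b => F b t) l (𝓝 (f t))) :
    Tendsto (fun b => cfc (F b) A) l (𝓝 (cfc f A)) := by
  refine tendsto_cfc_fun ?_ (Eventually.of_forall fun b => continuousOn_spectrum _ A)
  rw [Metric.tendstoUniformlyOn_iff]
  intro ε hε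
  refine (eventually_all_finite A.finite_real_spectrum).2 fun t ht => ?_
  filter_upwards [Metric.tendsto_nhds.1 (h t ht) ε hε] with b hb
  rwa [dist_comm]

lemma continuous_matPow (A : Matrix ι ι ℂ) : Continuous (matPow A) := by
  rw [funext (matPow_eq_cfc A), continuous_iff_continuousAt]
  intro x
  refine tendsto_cfc_of_pointwise fun t _ => ?_
  rcases eq_or_ne t 0 with rfl | h
  · simp [suppPow_zero_right]
  · simp only [suppPow_of_ne_zero h]
    exact (Real.continuous_const_rpow h).tendsto x

lemma tendsto_rpow_sub_one_div {s : ℝ} (hs : 0 < s) :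
    Tendsto (fun t : ℝ => t⁻¹ * (s ^ t - 1)) (𝓝[≠] 0) (𝓝 (Real.log s)) := by
  have h := (Real.hasStrictDerivAt_const_rpow hs 0).hasDerivAt.tendsto_slope
  simpa [slope_fun_def] using h

lemma tendsto_smul_matPow_sub_one {A : Matrix ι ι ℂ} (hA : A.PosDef) :
    Tendsto (fun t : ℝ => t⁻¹ • (matPow A t - 1)) (𝓝[≠] 0) (𝓝 (matLog A)) := by
  have e : ∀ t : ℝ, t⁻¹ • (matPow A t - 1) = cfc (fun x => t⁻¹ * (suppPow t x - 1)) A := by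
    intro t
    rw [cfc_const_mul t⁻¹ _ A (continuousOn_spectrum _ A), cfc_sub (suppPow t) (fun _ => 1) A
      (continuousOn_spectrum _ A) (continuousOn_spectrum _ A), matPow_eq_cfc,
      cfc_const_one ℝ A hA.1.isSelfAdjoint]
  simp only [e, matLog_eq_cfc]
  refine tendsto_cfc_of_pointwise fun x hx => ?_
  have h := pos_of_mem_spectrum hA hx
  simp only [suppPow_of_ne_zero h.ne']
  exact tendsto_rpow_sub_one_div h

lemma tendsto_smul_matPow_sub_self {A : Matrix ι ι ℂ} (hA : A.PosSemidef) :
    Tendsto (fun α : ℝ => (α - 1)⁻¹ • (matPow A α - A)) (𝓝[≠] 1) (𝓝 (A * matLog A)) := by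
  have e : ∀ α : ℝ, (α - 1)⁻¹ • (matPow A α - A) =
      cfc (fun x => (α - 1)⁻¹ * (suppPow α x - x)) A := by
    intro t
    rw [cfc_const_mul (t - 1)⁻¹ _ A (continuousOn_spectrum _ A), cfc_sub (suppPow t) (fun x => x) A
      (continuousOn_spectrum _ A) (continuousOn_spectrum _ A), matPow_eq_cfc,
      cfc_id' ℝ A hA.1.isSelfAdjoint]
  have e2 : A * matLog A = cfc (fun x => x * Real.log x) A := by
    rw [cfc_mul (fun x => x) Real.log A (continuousOn_spectrum _ A) (continuousOn_spectrum _ A),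
      cfc_id' ℝ A hA.1.isSelfAdjoint, matLog_eq_cfc]
  simp only [e, e2]
  refine tendsto_cfc_of_pointwise fun x hx => ?_
  rcases (nonneg_of_mem_spectrum hA hx).eq_or_lt with rfl | h
  · simp [suppPow_zero_right]
  · simp only [suppPow_of_ne_zero h.ne']
    have h1 := (Real.hasStrictDerivAt_const_rpow h 1).hasDerivAt.tendsto_slope
    simpa [slope_fun_def] using h1

/-- The operator `ρ^{α/(2z)} σ^{(1-α)/z} ρ^{α/(2z)}`. -/
noncomputable def sandwich (α z : ℝ) (ρ σ : Matrix ι ι ℂ) : Matrix ι ι ℂ :=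
  matPow ρ (α / (2 * z)) * matPow σ ((1 - α) / z) * matPow ρ (α / (2 * z))

lemma posSemidef_sandwich (α z : ℝ) (ρ : Matrix ι ι ℂ) {σ : Matrix ι ι ℂ} (hσ : σ.PosSemidef) :
    (sandwich α z ρ σ).PosSemidef := by
  have h := (posSemidef_matPow hσ ((1 - α) / z)).mul_mul_conjTranspose_same
    (matPow ρ (α / (2 * z)))
  rwa [(isHermitian_matPow ρ _).eq] at h

lemma Qaz_eq_reTrace_matPow_sandwich (α : ℝ) {z : ℝ} (hz : z ≠ 0) {ρ σ : Matrix ι ι ℂ}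
    (hρ : ρ.PosSemidef) (hσ : σ.PosSemidef) :
    Qaz α z ρ σ = reTrace (matPow (sandwich α z ρ σ) z) := by
  have h := trace_cfc_mul_conjTranspose_comm
    (matPow ρ (α / (2 * z)) * matPow σ ((1 - α) / (2 * z))) (suppPow z)
  rw [conjTranspose_mul, (isHermitian_matPow ρ _).eq, (isHermitian_matPow σ _).eq] at h
  rw [Qaz, sandwich, matPow_eq_cfc, matPow_eq_cfc (_ * _ * _)]
  convert h.symm using 3
  · rw [mul_assoc, mul_assoc, ← mul_assoc (matPow ρ _) (matPow ρ _), matPow_mul_matPow hρ]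
    congr 3; field_simp; ring
  · rw [mul_assoc, mul_assoc, ← mul_assoc (matPow σ _) (matPow σ _), matPow_mul_matPow hσ]
    congr 3; field_simp; ring

lemma sandwich_mul_kerProj (α z : ℝ) {ρ : Matrix ι ι ℂ} (hρ : ρ.PosSemidef)
    (σ : Matrix ι ι ℂ) : sandwich α z ρ σ * kerProj ρ = 0 := by
  rw [sandwich, mul_assoc, matPow_mul_kerProj hρ, mul_zero]

lemma matPow_sandwich_add_kerProj (α z : ℝ) {ρ σ : Matrix ι ι ℂ} (hρ : ρ.PosSemidef)
    (hσ : σ.PosSemidef) (x : ℝ) :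
    matPow (sandwich α z ρ σ + kerProj ρ) x = matPow (sandwich α z ρ σ) x + kerProj ρ :=
  matPow_add_of_mul_eq_zero (posSemidef_sandwich α z ρ hσ).1 (isHermitian_kerProj ρ)
    (kerProj_mul_self hρ) (sandwich_mul_kerProj α z hρ σ) x

lemma matPow_matPow_add_kerProj {ρ : Matrix ι ι ℂ} (hρ : ρ.PosSemidef) (x y : ℝ) :
    matPow (matPow ρ x + kerProj ρ) y = matPow ρ (x * y) + kerProj ρ := by
  rw [matPow_add_of_mul_eq_zero (isHermitian_matPow ρ x) (isHermitian_kerProj ρ)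
    (kerProj_mul_self hρ) (matPow_mul_kerProj hρ x), matPow_matPow hρ]

lemma matLog_matPow_add_kerProj {ρ : Matrix ι ι ℂ} (hρ : ρ.PosSemidef) (x : ℝ) :
    matLog (matPow ρ x + kerProj ρ) = x • matLog ρ := by
  rw [matLog_add_of_mul_eq_zero (isHermitian_matPow ρ x) (isHermitian_kerProj ρ)
    (kerProj_mul_self hρ) (matPow_mul_kerProj hρ x), matLog_matPow hρ]

lemma exists_forall_exp_smul_le_matPow {σ : Matrix ι ι ℂ} (hσ : σ.PosDef) :
    ∃ M : ℝ, 0 ≤ M ∧ ∀ t : ℝ, Real.exp (-(|t| * M)) • (1 : Matrix ι ι ℂ) ≤ matPow σ t ∧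
      matPow σ t ≤ Real.exp (|t| * M) • (1 : Matrix ι ι ℂ) := by
  obtain ⟨M, hM⟩ := (σ.finite_real_spectrum.image fun x => |Real.log x|).bddAbove
  have hlog : ∀ x ∈ spectrum ℝ σ, |Real.log x| ≤ max M 0 := fun x hx =>
    (hM (Set.mem_image_of_mem _ hx)).trans (le_max_left _ _)
  have hmul : ∀ t, ∀ x ∈ spectrum ℝ σ, |Real.log x * t| ≤ |t| * max M 0 := fun t x hx => by
    rw [abs_mul, mul_comm]
    exact mul_le_mul_of_nonneg_left (hlog x hx) (abs_nonneg t)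
  have hc : ∀ c : ℝ, c • (1 : Matrix ι ι ℂ) = cfc (fun _ => c) σ := fun c => by
    rw [cfc_const c σ hσ.1.isSelfAdjoint, Algebra.algebraMap_eq_smul_one]
  refine ⟨max M 0, le_max_right _ _, fun t => ⟨?_, ?_⟩⟩
  · rw [hc, matPow_eq_cfc]
    refine cfc_mono (fun x hx => ?_) (continuousOn_spectrum _ σ) (continuousOn_spectrum _ σ)
    have h := pos_of_mem_spectrum hσ hx
    rw [suppPow_of_ne_zero h.ne', Real.rpow_def_of_pos h]
    exact Real.exp_le_exp.2 (abs_le.1 (hmul t x hx)).1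
  · rw [hc, matPow_eq_cfc]
    refine cfc_mono (fun x hx => ?_) (continuousOn_spectrum _ σ) (continuousOn_spectrum _ σ)
    have h := pos_of_mem_spectrum hσ hx
    rw [suppPow_of_ne_zero h.ne', Real.rpow_def_of_pos h]
    exact Real.exp_le_exp.2 (abs_le.1 (hmul t x hx)).2

lemma matPow_mul_mul_matPow_mono (ρ : Matrix ι ι ℂ) (p : ℝ) {S T : Matrix ι ι ℂ} (h : S ≤ T) :
    matPow ρ p * S * matPow ρ p ≤ matPow ρ p * T * matPow ρ p := by
  have h' : (T - S).PosSemidef := h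
  have h1 := h'.mul_mul_conjTranspose_same (matPow ρ p)
  rw [(isHermitian_matPow ρ p).eq, mul_sub, sub_mul] at h1
  exact h1

lemma matPow_half_mul_self {ρ : Matrix ι ι ℂ} (hρ : ρ.PosSemidef) (α z : ℝ) :
    matPow ρ (α / (2 * z)) * matPow ρ (α / (2 * z)) = matPow ρ (α / z) := by
  rw [matPow_mul_matPow hρ]
  congr 1
  ring

lemma exp_smul_le_sandwich_add_kerProj {ρ σ : Matrix ι ι ℂ} (hρ : ρ.PosSemidef) {α z δ : ℝ}
    (hδ : 0 ≤ δ) (h : Real.exp (-δ) • (1 : Matrix ι ι ℂ) ≤ matPow σ ((1 - α) / z)) :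
    Real.exp (-δ) • (matPow ρ (α / z) + kerProj ρ) ≤ sandwich α z ρ σ + kerProj ρ := by
  have h1 := matPow_mul_mul_matPow_mono ρ (α / (2 * z)) h
  rw [mul_smul_comm, mul_one, smul_mul_assoc, matPow_half_mul_self hρ] at h1
  rw [smul_add]
  refine add_le_add h1 ?_
  have h2 : (((1 - Real.exp (-δ)) • kerProj ρ)).PosSemidef :=
    (posSemidef_kerProj hρ).smul (by simpa using hδ)
  rw [sub_smul, one_smul] at h2
  exact h2

lemma sandwich_add_kerProj_le_exp_smul {ρ σ : Matrix ι ι ℂ} (hρ : ρ.PosSemidef) {α z δ : ℝ}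
    (hδ : 0 ≤ δ) (h : matPow σ ((1 - α) / z) ≤ Real.exp δ • (1 : Matrix ι ι ℂ)) :
    sandwich α z ρ σ + kerProj ρ ≤ Real.exp δ • (matPow ρ (α / z) + kerProj ρ) := by
  have h1 := matPow_mul_mul_matPow_mono ρ (α / (2 * z)) h
  rw [mul_smul_comm, mul_one, smul_mul_assoc, matPow_half_mul_self hρ] at h1
  rw [smul_add]
  refine add_le_add h1 ?_
  have h2 : (((Real.exp δ - 1) • kerProj ρ)).PosSemidef :=
    (posSemidef_kerProj hρ).smul (by simpa using hδ)
  rw [sub_smul, one_smul] at h2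
  exact h2

lemma posDef_sandwich_add_kerProj {ρ σ : Matrix ι ι ℂ} (hρ : ρ.PosSemidef) (hσ : σ.PosDef)
    (α z : ℝ) : (sandwich α z ρ σ + kerProj ρ).PosDef := by
  obtain ⟨M, hM, h⟩ := exists_forall_exp_smul_le_matPow hσ
  have h1 := exp_smul_le_sandwich_add_kerProj hρ (by positivity) (h ((1 - α) / z)).1
  have h2 := (posDef_matPow_add_kerProj hρ (α / z)).smul
    (Real.exp_pos (-(|(1 - α) / z| * M)))
  exact isStrictlyPositive_iff_posDef.1 ((isStrictlyPositive_iff_posDef.2 h2).of_le h1)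

lemma abs_Qaz_sub_le {ρ σ : Matrix ι ι ℂ} (hρ : ρ.PosSemidef) (hσ : σ.PosDef) (α : ℝ) {z : ℝ}
    (hz : 0 < z) (r : ℝ) :
    |r * (Qaz α z ρ σ - reTrace (matPow ρ α)) -
        reTrace (matPow ρ α * ((r * z) • (matPow σ ((1 - α) / z) - 1)))| ≤
      |reTrace ((matPow (sandwich α z ρ σ + kerProj ρ) (z - 1) -
        matPow (matPow ρ (α / z) + kerProj ρ) (z - 1)) *
          (matPow ρ (α / (2 * z)) * ((r * z) • (matPow σ ((1 - α) / z) - 1)) *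
            matPow ρ (α / (2 * z))))| := by
  have h := abs_trace_matPow_sub_le (posDef_matPow_add_kerProj hρ (α / z))
    (posDef_sandwich_add_kerProj hρ hσ α z) hz
  have e1 : sandwich α z ρ σ + kerProj ρ - (matPow ρ (α / z) + kerProj ρ) =
      matPow ρ (α / (2 * z)) * (matPow σ ((1 - α) / z) - 1) * matPow ρ (α / (2 * z)) := by
    rw [mul_sub, sub_mul, mul_one, matPow_half_mul_self hρ, sandwich, add_sub_add_right_eq_sub]
  have e2 : reTrace (matPow (matPow ρ (α / z) + kerProj ρ) (z - 1) *
      (matPow ρ (α / (2 * z)) * (matPow σ ((1 - α) / z) - 1) * matPow ρ (α / (2 * z)))) =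
      reTrace (matPow ρ α * (matPow σ ((1 - α) / z) - 1)) := by
    rw [← mul_assoc, reTrace_mul_comm, ← mul_assoc, ← mul_assoc, matPow_matPow_add_kerProj hρ,
      mul_add, matPow_mul_kerProj hρ, add_zero, matPow_mul_matPow hρ, matPow_mul_matPow hρ]
    congr 3
    field_simp
    ring
  rw [e1, e2, matPow_matPow_add_kerProj hρ, matPow_sandwich_add_kerProj α z hρ hσ.posSemidef,
    reTrace_add, reTrace_add, add_sub_add_right_eq_sub, div_mul_cancel₀ _ hz.ne',
    ← Qaz_eq_reTrace_matPow_sandwich α hz.ne' hρ hσ.posSemidef] at h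
  have h' := mul_le_mul_of_nonneg_left h (abs_nonneg r)
  rw [← abs_mul, ← abs_mul] at h'
  simp only [mul_smul_comm, smul_mul_assoc, reTrace_smul]
  refine le_of_eq_of_le (congrArg abs ?_) (h'.trans_eq (congrArg abs ?_)) <;> ring

lemma norm_matLog_sandwich_add_kerProj_sub_le {ρ σ : Matrix ι ι ℂ} (hρ : ρ.PosSemidef)
    (hσ : σ.PosDef) {α z δ : ℝ} (hδ : 0 ≤ δ)
    (h1 : Real.exp (-δ) • (1 : Matrix ι ι ℂ) ≤ matPow σ ((1 - α) / z))
    (h2 : matPow σ ((1 - α) / z) ≤ Real.exp δ • (1 : Matrix ι ι ℂ)) :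
    ‖matLog (sandwich α z ρ σ + kerProj ρ) - (α / z) • matLog ρ‖ ≤ δ := by
  rw [← matLog_matPow_add_kerProj hρ]
  exact norm_matLog_sub_le (posDef_matPow_add_kerProj hρ _)
    (posDef_sandwich_add_kerProj hρ hσ α z) hδ (exp_smul_le_sandwich_add_kerProj hρ hδ h1)
    (sandwich_add_kerProj_le_exp_smul hρ hδ h2)

lemma tendsto_matPow_sandwich_sub {ρ σ : Matrix ι ι ℂ} (hρ : ρ.PosSemidef) (hσ : σ.PosDef)
    {l : Filter ℝ} (hl : l ≤ 𝓝 1) {z : ℝ → ℝ} {c : ℝ} (hc : 0 < c) (hz : ∀ᶠ α in l, c ≤ z α) :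
    Tendsto (fun α => matPow (sandwich α (z α) ρ σ + kerProj ρ) (z α - 1) -
      matPow (matPow ρ (α / z α) + kerProj ρ) (z α - 1)) l (𝓝 0) := by
  obtain ⟨M, hM, h⟩ := exists_forall_exp_smul_le_matPow hσ
  have hb : ∀ᶠ α in l, 0 < z α ∧ |(z α - 1) / z α| ≤ 1 + 1 / c := by
    filter_upwards [hz] with α hα
    have h0 : 0 < z α := hc.trans_le hα
    have h1 : 1 / z α ≤ 1 / c := one_div_le_one_div_of_le hc hα
    have h2 : 0 < 1 / z α := by positivity
    refine ⟨h0, ?_⟩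
    rw [sub_div, div_self h0.ne', abs_le]
    constructor <;> linarith
  have e : ∀ α, matPow (sandwich α (z α) ρ σ + kerProj ρ) (z α - 1) -
      matPow (matPow ρ (α / z α) + kerProj ρ) (z α - 1) =
      NormedSpace.exp ((z α - 1) • matLog (sandwich α (z α) ρ σ + kerProj ρ)) -
      NormedSpace.exp ((z α - 1) • (α / z α) • matLog ρ) := fun α => by
    rw [← matLog_matPow_add_kerProj hρ, ← matPow_eq_exp (posDef_matPow_add_kerProj hρ _),
      ← matPow_eq_exp (posDef_sandwich_add_kerProj hρ hσ _ _)]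
  simp only [e]
  refine tendsto_exp_sub_exp (C := (1 + 1 / c) * 2 * ‖matLog ρ‖) ?_ ?_
  · have h0 : Tendsto (fun α : ℝ => (1 + 1 / c) * (|1 - α| * M)) l (𝓝 0) := by
      have : Continuous fun α : ℝ => (1 + 1 / c) * (|1 - α| * M) := by fun_prop
      simpa using (this.tendsto 1).mono_left hl
    refine squeeze_zero_norm' ?_ h0
    filter_upwards [hb] with α ⟨h1, h2⟩
    have h3 := norm_matLog_sandwich_add_kerProj_sub_le hρ hσ
      (by positivity) (h ((1 - α) / z α)).1 (h ((1 - α) / z α)).2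
    rw [← smul_sub, norm_smul, Real.norm_eq_abs]
    calc |z α - 1| * _ ≤ |z α - 1| * (|(1 - α) / z α| * M) :=
          mul_le_mul_of_nonneg_left h3 (abs_nonneg _)
      _ = |(z α - 1) / z α| * (|1 - α| * M) := by rw [abs_div, abs_div]; ring
      _ ≤ _ := mul_le_mul_of_nonneg_right h2 (by positivity)
  · have h1 : ∀ᶠ α in l, |α| < 2 :=
      hl (continuous_abs.continuousAt.eventually_lt continuousAt_const (by norm_num))
    filter_upwards [hb, h1] with α ⟨_, h2⟩ h1
    rw [smul_smul, norm_smul, Real.norm_eq_abs,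
      show (z α - 1) * (α / z α) = (z α - 1) / z α * α by ring, abs_mul]
    gcongr

lemma reTrace_continuous : Continuous (reTrace : Matrix ι ι ℂ → ℝ) :=
  Complex.continuous_re.comp continuous_id.matrix_trace

/-- The derivative of `Q_{α,z(α)}` at `α = 1` along a path with `z` bounded away from zero. -/
lemma tendsto_slope_Qaz {ρ σ : Matrix ι ι ℂ} (hρ : ρ.PosSemidef) (hσ : σ.PosDef)
    {l : Filter ℝ} (hl : l ≤ 𝓝[≠] 1) {z : ℝ → ℝ} {c : ℝ} (hc : 0 < c)
    (hz : ∀ᶠ α in l, c ≤ z α) :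
    Tendsto (fun α => (α - 1)⁻¹ * (Qaz α (z α) ρ σ - reTrace ρ)) l
      (𝓝 (reTrace (ρ * (matLog ρ - matLog σ)))) := by
  have hl1 : l ≤ 𝓝 1 := hl.trans nhdsWithin_le_nhds
  have hid : Tendsto (fun α : ℝ => α) l (𝓝 1) := hl1
  have hne : ∀ᶠ α in l, α ≠ 1 := hl self_mem_nhdsWithin
  have hs : Tendsto (fun α => (1 - α) / z α) l (𝓝[≠] 0) := by
    rw [tendsto_nhdsWithin_iff]
    constructor
    · have h0 : Tendsto (fun α : ℝ => |1 - α| / c) l (𝓝 0) := by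
        have : Continuous fun α : ℝ => |1 - α| / c := by fun_prop
        simpa using (this.tendsto 1).mono_left hl1
      refine squeeze_zero_norm' ?_ h0
      filter_upwards [hz] with α hα
      rw [norm_div, Real.norm_eq_abs, Real.norm_of_nonneg (hc.le.trans hα)]
      gcongr
    · filter_upwards [hz, hne] with α h1 h2
      exact div_ne_zero (sub_ne_zero.2 h2.symm) (hc.trans_le h1).ne'
  have hG : Tendsto (fun α => ((α - 1)⁻¹ * z α) • (matPow σ ((1 - α) / z α) - 1)) l
      (𝓝 (-matLog σ)) := by
    refine ((tendsto_smul_matPow_sub_one hσ).comp hs).neg.congr' ?_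
    filter_upwards [hne] with α h2
    rw [Function.comp_apply, ← neg_smul, inv_div, ← div_neg, neg_sub, inv_mul_eq_div]
  have hA : Tendsto (fun α => matPow ρ α) l (𝓝 ρ) := by
    have := ((continuous_matPow ρ).tendsto 1).comp hid
    rwa [matPow_one hρ.1] at this
  have ha : ∃ C : ℝ, ∀ᶠ α in l, ‖matPow ρ (α / (2 * z α))‖ ≤ C := by
    obtain ⟨C, hC⟩ := (isCompact_Icc (a := (0 : ℝ)) (b := 1 / c)).exists_bound_of_continuousOn
      (continuous_matPow ρ).continuousOn
    refine ⟨C, ?_⟩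
    filter_upwards [hz, hid.eventually (lt_mem_nhds one_pos),
      hid.eventually (gt_mem_nhds one_lt_two)] with α h1 h2 h3
    have h0 : 0 < z α := hc.trans_le h1
    refine hC _ ⟨by positivity, ?_⟩
    calc α / (2 * z α) ≤ 2 / (2 * z α) := by gcongr
      _ = 1 / z α := by field_simp
      _ ≤ 1 / c := one_div_le_one_div_of_le hc h1
  obtain ⟨C, hC⟩ := ha
  have hbd : Asymptotics.IsBigO l (fun α => matPow ρ (α / (2 * z α))) (fun _ => (1 : ℝ)) :=
    Asymptotics.IsBigO.of_bound C (by simpa using hC)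
  have hD := tendsto_matPow_sandwich_sub hρ hσ hl1 hc hz
  have herr := (Asymptotics.isLittleO_one_iff ℝ).2 hD |>.mul_isBigO
    ((hbd.mul (hG.isBigO_one ℝ)).mul hbd)
  simp only [mul_one] at herr
  have herr' := (reTrace_continuous.tendsto (0 : Matrix ι ι ℂ)).comp
    ((Asymptotics.isLittleO_one_iff ℝ).1 herr)
  have h0 : reTrace (0 : Matrix ι ι ℂ) = 0 := by simp [reTrace]
  rw [h0] at herr'
  have hzero := squeeze_zero_norm' (f := fun α => (α - 1)⁻¹ *
    (Qaz α (z α) ρ σ - reTrace (matPow ρ α)) - reTrace (matPow ρ α *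
      (((α - 1)⁻¹ * z α) • (matPow σ ((1 - α) / z α) - 1)))) (by
    filter_upwards [hz] with α hα
    exact abs_Qaz_sub_le hρ hσ α (hc.trans_le hα) (α - 1)⁻¹) (by simpa using herr'.abs)
  have h1 := (reTrace_continuous.tendsto _).comp (hA.mul hG)
  have h2 := (reTrace_continuous.tendsto _).comp ((tendsto_smul_matPow_sub_self hρ).mono_left hl)
  convert (hzero.add h1).add h2 using 2
  · simp only [Function.comp_apply, reTrace_smul, reTrace_sub]
    ring
  · rw [zero_add, ← reTrace_add, ← mul_add, neg_add_eq_sub]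

lemma reTrace_nonneg {A : Matrix ι ι ℂ} (hA : A.PosSemidef) : 0 ≤ reTrace A :=
  (Complex.le_def.1 hA.trace_nonneg).1

lemma reTrace_mul_pos {A K : Matrix ι ι ℂ} (hA : A.PosSemidef) (hK : K.IsHermitian)
    (hKK : K * K = K) (h : A * K ≠ 0) : 0 < reTrace (A * K) := by
  have hs := (isHermitian_matPow A (1 / 2)).eq
  have e : matPow A (1 / 2) * matPow A (1 / 2) = A := by
    rw [matPow_mul_matPow hA, add_halves, matPow_one hA.1]
  have e2 : (matPow A (1 / 2) * K)ᴴ * (matPow A (1 / 2) * K) = K * (A * K) := by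
    rw [conjTranspose_mul, hs, hK.eq, mul_assoc, ← mul_assoc (matPow A _) (matPow A _), e]
  have e3 : reTrace (A * K) = reTrace (K * (A * K)) := by
    rw [reTrace_mul_comm K (A * K), mul_assoc, hKK]
  have hp := posSemidef_conjTranspose_mul_self (matPow A (1 / 2) * K)
  rw [e3, ← e2]
  refine (reTrace_nonneg hp).lt_of_ne fun h0 => h ?_
  have h1 : ((matPow A (1 / 2) * K)ᴴ * (matPow A (1 / 2) * K)).trace = 0 :=
    Complex.ext h0.symm (Complex.le_def.1 hp.trace_nonneg).2.symm
  rw [trace_conjTranspose_mul_self_eq_zero_iff] at h1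
  rw [← e, mul_assoc, h1, mul_zero]

lemma reTrace_pos {A : Matrix ι ι ℂ} (hA : PSDne A) : 0 < reTrace A := by
  simpa using reTrace_mul_pos hA.1 isHermitian_one (one_mul 1) (by simpa using hA.2)

lemma suppLE_iff_mul_kerProj_eq_zero {ρ σ : Matrix ι ι ℂ} (hσ : σ.PosSemidef) :
    suppLE ρ σ ↔ ρ * kerProj σ = 0 := by
  constructor
  · intro h
    refine Matrix.ext_of_mulVec_single fun i => ?_
    rw [zero_mulVec, ← mulVec_mulVec]
    refine h _ ?_
    rw [mulVec_mulVec, mul_kerProj hσ, zero_mulVec]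
  · intro h v hv
    have h0 : matPow σ 0 *ᵥ v = 0 := by
      have e : matPow σ 0 = matPow σ (-1) * σ := by
        nth_rw 3 [← matPow_one hσ.1]
        rw [matPow_mul_matPow hσ, neg_add_cancel]
      rw [e, ← mulVec_mulVec, hv, mulVec_zero]
    have h1 : kerProj σ *ᵥ v = v := by rw [kerProj, sub_mulVec, one_mulVec, h0, sub_zero]
    rw [← h1, mulVec_mulVec, h, zero_mulVec]

lemma suppLE_of_posDef (ρ : Matrix ι ι ℂ) {σ : Matrix ι ι ℂ} (hσ : σ.PosDef) : suppLE ρ σ := by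
  intro v hv
  have := (mulVec_injective_iff_isUnit.2 hσ.isUnit) (hv.trans (mulVec_zero σ).symm)
  rw [this, mulVec_zero]

lemma tendsto_inv_mul_log_sub_log {l : Filter ℝ} (hl : l ≤ 𝓝[≠] 1) {q : ℝ → ℝ} {T d : ℝ}
    (hT : 0 < T) (h : Tendsto (fun α => (α - 1)⁻¹ * (q α - T)) l (𝓝 d)) :
    Tendsto q l (𝓝 T) ∧
      Tendsto (fun α => (α - 1)⁻¹ * (Real.log (q α) - Real.log T)) l (𝓝 (T⁻¹ * d)) := by
  have hne : ∀ᶠ α in l, α ≠ 1 := hl self_mem_nhdsWithin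
  have hid : Tendsto (fun α : ℝ => α) l (𝓝 1) := hl.trans nhdsWithin_le_nhds
  have hq : Tendsto q l (𝓝 T) := by
    have h1 := ((hid.sub_const 1).mul h).add_const T
    rw [sub_self, zero_mul, zero_add] at h1
    refine h1.congr' ?_
    filter_upwards [hne] with α hα
    rw [mul_inv_cancel_left₀ (sub_ne_zero.2 hα), sub_add_cancel]
  refine ⟨hq, ?_⟩
  have hd : Tendsto (dslope Real.log T) (𝓝 T) (𝓝 T⁻¹) := by
    have := (continuousAt_dslope_same.2 (Real.differentiableAt_log hT.ne')).tendsto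
    rwa [dslope_same, Real.deriv_log] at this
  refine ((hd.comp hq).mul h).congr fun α => ?_
  have := sub_smul_dslope Real.log T (q α)
  rw [smul_eq_mul] at this
  rw [← this, Function.comp_apply]
  ring

lemma tendsto_Daz_of_posDef {ρ σ : Matrix ι ι ℂ} (hρ : PSDne ρ) (hσ : σ.PosDef)
    {l : Filter ℝ} (hl : l ≤ 𝓝[≠] 1) {z : ℝ → ℝ} {c : ℝ} (hc : 0 < c)
    (hz : ∀ᶠ α in l, c ≤ z α) :
    Tendsto (fun α => Daz α (z α) ρ σ) l (𝓝 (DUm ρ σ)) := by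
  obtain ⟨h1, h2⟩ := tendsto_inv_mul_log_sub_log hl (reTrace_pos hρ)
    (tendsto_slope_Qaz hρ.1 hσ hl hc hz)
  rw [DUm, if_pos (suppLE_of_posDef ρ hσ)]
  refine ((continuous_coe_real_ereal.tendsto _).comp h2).congr' ?_
  filter_upwards [h1.eventually_ne (reTrace_pos hρ).ne'] with α hα
  rw [Daz, if_pos ⟨Or.inl (suppLE_of_posDef ρ hσ), hα⟩, Function.comp_apply]

lemma matPow_mul_kerProj_of_suppLE {ρ σ : Matrix ι ι ℂ} (hρ : ρ.PosSemidef) (hσ : σ.PosSemidef)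
    (h : suppLE ρ σ) (p : ℝ) : matPow ρ p * kerProj σ = 0 := by
  have e : matPow ρ p = matPow ρ (p - 1) * ρ := by
    nth_rw 3 [← matPow_one hρ.1]
    rw [matPow_mul_matPow hρ, sub_add_cancel]
  rw [e, mul_assoc, (suppLE_iff_mul_kerProj_eq_zero hσ).1 h, mul_zero]

lemma matPow_add_smul_kerProj {σ : Matrix ι ι ℂ} (hσ : σ.PosSemidef) (ε t : ℝ) :
    matPow (σ + ε • kerProj σ) t = matPow σ t + suppPow t ε • kerProj σ := by
  rw [matPow_eq_cfc, matPow_eq_cfc, cfc_add_smul_of_mul_eq_zero hσ.1 (isHermitian_kerProj σ)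
    (kerProj_mul_self hσ) (mul_kerProj hσ) ε (suppPow_zero_right t)]

lemma matLog_add_smul_kerProj {σ : Matrix ι ι ℂ} (hσ : σ.PosSemidef) (ε : ℝ) :
    matLog (σ + ε • kerProj σ) = matLog σ + Real.log ε • kerProj σ := by
  rw [matLog_eq_cfc, matLog_eq_cfc, cfc_add_smul_of_mul_eq_zero hσ.1 (isHermitian_kerProj σ)
    (kerProj_mul_self hσ) (mul_kerProj hσ) ε Real.log_zero]

lemma tendsto_Daz_of_suppLE {ρ σ : Matrix ι ι ℂ} (hρ : PSDne ρ) (hσ : σ.PosSemidef)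
    (h : suppLE ρ σ) {l : Filter ℝ} (hl : l ≤ 𝓝[≠] 1) {z : ℝ → ℝ} {c : ℝ} (hc : 0 < c)
    (hz : ∀ᶠ α in l, c ≤ z α) :
    Tendsto (fun α => Daz α (z α) ρ σ) l (𝓝 (DUm ρ σ)) := by
  have hσ' := posDef_add_smul_kerProj hσ one_pos
  have hs := suppLE_of_posDef ρ hσ'
  have hD : DUm ρ (σ + (1 : ℝ) • kerProj σ) = DUm ρ σ := by
    rw [DUm, DUm, if_pos hs, if_pos h, matLog_add_smul_kerProj hσ, Real.log_one, zero_smul,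
      add_zero]
  rw [← hD]
  refine (tendsto_Daz_of_posDef hρ hσ' hl hc hz).congr' ?_
  filter_upwards [hz] with α hα
  have h0 : z α ≠ 0 := (hc.trans_le hα).ne'
  have hQ : Qaz α (z α) ρ (σ + (1 : ℝ) • kerProj σ) = Qaz α (z α) ρ σ := by
    rw [Qaz_eq_reTrace_matPow_sandwich α h0 hρ.1 hσ,
      Qaz_eq_reTrace_matPow_sandwich α h0 hρ.1 hσ'.posSemidef, sandwich, sandwich,
      matPow_add_smul_kerProj hσ, mul_add, mul_smul_comm, matPow_mul_kerProj_of_suppLE hρ.1 hσ h,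
      smul_zero, add_zero]
  simp only [Daz, hQ, hs, h]

lemma Qaz_le_Qaz_add_smul_kerProj {ρ σ : Matrix ι ι ℂ} (hρ : ρ.PosSemidef) (hσ : σ.PosSemidef)
    {ε : ℝ} (hε : 0 < ε) (α : ℝ) {z : ℝ} (hz : 0 < z) :
    Qaz α z ρ σ ≤ Qaz α z ρ (σ + ε • kerProj σ) := by
  have hσ' := posDef_add_smul_kerProj hσ hε
  have h1 : matPow σ ((1 - α) / z) ≤ matPow (σ + ε • kerProj σ) ((1 - α) / z) := by
    rw [matPow_add_smul_kerProj hσ, le_add_iff_nonneg_right, nonneg_iff_posSemidef]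
    exact (posSemidef_kerProj hσ).smul (suppPow_nonneg _ hε.le)
  have h2 : sandwich α z ρ σ + kerProj ρ ≤ sandwich α z ρ (σ + ε • kerProj σ) + kerProj ρ :=
    add_le_add_left (matPow_mul_mul_matPow_mono ρ _ h1) _
  have h3 := trace_matPow_le ((posSemidef_sandwich α z ρ hσ).add (posSemidef_kerProj hρ))
    (posDef_sandwich_add_kerProj hρ hσ' α z) h2 hz
  rw [matPow_sandwich_add_kerProj α z hρ hσ, matPow_sandwich_add_kerProj α z hρ hσ'.posSemidef,
    reTrace_add, reTrace_add] at h3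
  rw [Qaz_eq_reTrace_matPow_sandwich α hz.ne' hρ hσ,
    Qaz_eq_reTrace_matPow_sandwich α hz.ne' hρ hσ'.posSemidef]
  linarith

lemma Qaz_nonneg {ρ σ : Matrix ι ι ℂ} (hρ : ρ.PosSemidef) (hσ : σ.PosSemidef) (α : ℝ) {z : ℝ}
    (hz : z ≠ 0) : 0 ≤ Qaz α z ρ σ := by
  rw [Qaz_eq_reTrace_matPow_sandwich α hz hρ hσ]
  exact reTrace_nonneg (posSemidef_matPow (posSemidef_sandwich α z ρ hσ) z)

lemma Daz_add_smul_kerProj_le {ρ σ : Matrix ι ι ℂ} (hρ : ρ.PosSemidef) (hσ : σ.PosSemidef)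
    (h : ¬ suppLE ρ σ) {ε : ℝ} (hε : 0 < ε) (α : ℝ) {z : ℝ} (hz : 0 < z) :
    Daz α z ρ (σ + ε • kerProj σ) ≤ Daz α z ρ σ := by
  have hs := suppLE_of_posDef ρ (posDef_add_smul_kerProj hσ hε)
  by_cases h1 : (suppLE ρ σ ∨ α < 1) ∧ Qaz α z ρ σ ≠ 0
  · have h2 := h1.1.resolve_left h
    have h3 := (Qaz_nonneg hρ hσ α hz.ne').lt_of_ne h1.2.symm
    have h4 := Qaz_le_Qaz_add_smul_kerProj hρ hσ hε α hz
    rw [Daz, Daz, if_pos h1, if_pos ⟨Or.inl hs, (h3.trans_le h4).ne'⟩, EReal.coe_le_coe_iff]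
    exact mul_le_mul_of_nonpos_left (sub_le_sub_right (Real.log_le_log h3 h4) _)
      (inv_nonpos.2 (by linarith))
  · rw [Daz.eq_def α z ρ σ, if_neg h1]
    exact le_top

lemma tendsto_Daz_of_not_suppLE {ρ σ : Matrix ι ι ℂ} (hρ : PSDne ρ) (hσ : σ.PosSemidef)
    (h : ¬ suppLE ρ σ) {l : Filter ℝ} (hl : l ≤ 𝓝[≠] 1) {z : ℝ → ℝ} {c : ℝ} (hc : 0 < c)
    (hz : ∀ᶠ α in l, c ≤ z α) :
    Tendsto (fun α => Daz α (z α) ρ σ) l (𝓝 (DUm ρ σ)) := by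
  rw [DUm, if_neg h, EReal.tendsto_nhds_top_iff_real]
  intro y
  have hT := reTrace_pos hρ
  have hκ := reTrace_mul_pos hρ.1 (isHermitian_kerProj σ) (kerProj_mul_self hσ)
    fun h0 => h ((suppLE_iff_mul_kerProj_eq_zero hσ).2 h0)
  set T := reTrace ρ
  set κ := reTrace (ρ * kerProj σ)
  set d := reTrace (ρ * (matLog ρ - matLog σ))
  set N := (T * (y + 1) - d) / κ
  have hε := Real.exp_pos (-N)
  have hσ' := posDef_add_smul_kerProj hσ hε
  have hD : DUm ρ (σ + Real.exp (-N) • kerProj σ) = ((y + 1 : ℝ) : EReal) := by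
    rw [DUm, if_pos (suppLE_of_posDef ρ hσ'), matLog_add_smul_kerProj hσ, Real.log_exp,
      ← sub_sub, mul_sub, reTrace_sub, mul_smul_comm, reTrace_smul]
    congr 1
    change T⁻¹ * (d - -N * κ) = y + 1
    have : N * κ = T * (y + 1) - d := div_mul_cancel₀ _ hκ.ne'
    rw [neg_mul, sub_neg_eq_add, this, add_sub_cancel, inv_mul_cancel_left₀ hT.ne']
  have h1 := tendsto_Daz_of_posDef hρ hσ' hl hc hz
  rw [hD] at h1
  filter_upwards [h1.eventually (lt_mem_nhds (EReal.coe_lt_coe_iff.2 (lt_add_one y))), hz]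
    with α h2 h3
  exact h2.trans_le (Daz_add_smul_kerProj_le hρ.1 hσ h hε α (hc.trans_le h3))

lemma tendsto_Daz {ρ σ : Matrix ι ι ℂ} (hρ : PSDne ρ) (hσ : σ.PosSemidef)
    {l : Filter ℝ} (hl : l ≤ 𝓝[≠] 1) {z : ℝ → ℝ} {c : ℝ} (hc : 0 < c)
    (hz : ∀ᶠ α in l, c ≤ z α) :
    Tendsto (fun α => Daz α (z α) ρ σ) l (𝓝 (DUm ρ σ)) := by
  by_cases h : suppLE ρ σ
  · exact tendsto_Daz_of_suppLE hρ hσ h hl hc hz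
  · exact tendsto_Daz_of_not_suppLE hρ hσ h hl hc hz

lemma matPow_zero_left {x : ℝ} : matPow (0 : Matrix ι ι ℂ) x = 0 := by
  rw [matPow_eq_cfc, cfc_apply_zero, suppPow_zero_right, map_zero]

lemma reTrace_matPow_eq_zero_iff {A : Matrix ι ι ℂ} (hA : A.PosSemidef) {z : ℝ} (hz : z ≠ 0) :
    reTrace (matPow A z) = 0 ↔ A = 0 := by
  constructor
  · intro h
    have h1 : matPow A z = 0 := by
      by_contra h2
      exact (reTrace_pos ⟨posSemidef_matPow hA z, h2⟩).ne' h
    rw [← matPow_one hA.1, ← mul_inv_cancel₀ hz, ← matPow_matPow hA, h1, matPow_zero_left]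
  · rintro rfl
    simp [matPow_zero_left, reTrace]

lemma matPow_mul_matPow_eq_zero_iff {ρ σ : Matrix ι ι ℂ} (hρ : ρ.PosSemidef)
    (hσ : σ.PosSemidef) (p q : ℝ) :
    matPow ρ p * matPow σ q = 0 ↔ matPow ρ 0 * matPow σ 0 = 0 := by
  have key : ∀ p q p' q' : ℝ, matPow ρ p * matPow σ q = 0 → matPow ρ p' * matPow σ q' = 0 := by
    intro p q p' q' h
    have : matPow ρ p' * matPow σ q' =
        matPow ρ (p' - p) * (matPow ρ p * matPow σ q) * matPow σ (q' - q) := by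
      rw [← mul_assoc, matPow_mul_matPow hρ, mul_assoc, matPow_mul_matPow hσ, sub_add_cancel,
        add_sub_cancel]
    rw [this, h, mul_zero, zero_mul]
  exact ⟨key p q 0 0, key 0 0 p q⟩

lemma Qaz_eq_zero_iff {ρ σ : Matrix ι ι ℂ} (hρ : ρ.PosSemidef) (hσ : σ.PosSemidef) (α : ℝ)
    {z : ℝ} (hz : z ≠ 0) : Qaz α z ρ σ = 0 ↔ matPow ρ 0 * matPow σ 0 = 0 := by
  rw [Qaz_eq_reTrace_matPow_sandwich α hz hρ hσ,
    reTrace_matPow_eq_zero_iff (posSemidef_sandwich α z ρ hσ) hz,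
    ← matPow_mul_matPow_eq_zero_iff hρ hσ (α / (2 * z)) ((1 - α) / (2 * z)),
    ← self_mul_conjTranspose_eq_zero (A := matPow ρ _ * _), conjTranspose_mul,
    (isHermitian_matPow ρ _).eq, (isHermitian_matPow σ _).eq, sandwich, mul_assoc,
    mul_assoc, ← mul_assoc (matPow σ _),
    matPow_half_mul_self hσ]

lemma tendsto_matPow_of_tendsto {β : Type*} {l : Filter β} {Z : β → Matrix ι ι ℂ}
    {Z₀ : Matrix ι ι ℂ} {z : β → ℝ} {z₀ : ℝ} (hZ : Tendsto Z l (𝓝 Z₀))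
    (hpos : ∀ b, (Z b).PosSemidef) (hpos₀ : Z₀.PosSemidef) (hz : Tendsto z l (𝓝 z₀))
    (hz₀ : 0 < z₀) : Tendsto (fun b => matPow (Z b) (z b)) l (𝓝 (matPow Z₀ z₀)) := by
  set M := (‖Z₀‖ + 1) * ‖(1 : Matrix ι ι ℂ)‖
  have hsp : ∀ A : Matrix ι ι ℂ, A.PosSemidef → ‖A‖ ≤ ‖Z₀‖ + 1 → spectrum ℝ A ⊆ Icc 0 M := by
    intro A hA hn x hx
    refine ⟨nonneg_of_mem_spectrum hA hx, (le_abs_self x).trans ?_⟩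
    exact (spectrum.norm_le_norm_mul_of_mem hx).trans
      (mul_le_mul_of_nonneg_right hn (norm_nonneg _))
  have hs : ∀ᶠ b in l, spectrum ℝ (Z b) ⊆ Icc 0 M := by
    filter_upwards [hZ.norm.eventually (gt_mem_nhds (lt_add_one ‖Z₀‖))] with b hb
    exact hsp _ (hpos b) hb.le
  have hcont : ContinuousOn (suppPow z₀) (Icc 0 M) := by
    rw [funext (suppPow_of_pos hz₀)]
    exact (Real.continuous_rpow_const hz₀.le).continuousOn
  have h1 : Tendsto (fun b => cfc (suppPow z₀) (Z b)) l (𝓝 (cfc (suppPow z₀) Z₀)) :=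
    hZ.cfc isCompact_Icc (suppPow z₀) hs
      (Eventually.of_forall fun b => (hpos b).1.isSelfAdjoint)
      (hsp _ hpos₀ (by linarith)) hpos₀.1.isSelfAdjoint hcont
  have h2 : Tendsto (fun b => cfc (suppPow (z b)) (Z b) - cfc (suppPow z₀) (Z b)) l (𝓝 0) := by
    have hu : UniformContinuousOn (fun p : ℝ × ℝ => p.2 ^ p.1)
        (Icc (z₀ / 2) (2 * z₀) ×ˢ Icc 0 M) := by
      refine (isCompact_Icc.prod isCompact_Icc).uniformContinuousOn_of_continuous ?_
      refine continuousOn_snd.rpow continuousOn_fst fun p hp => Or.inr ?_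
      linarith [hp.1.1]
    rw [Metric.uniformContinuousOn_iff] at hu
    rw [Metric.tendsto_nhds]
    intro ε hε
    obtain ⟨δ, hδ, H⟩ := hu (ε / 2) (half_pos hε)
    filter_upwards [hs, Metric.tendsto_nhds.1 hz δ hδ,
      hz.eventually (Icc_mem_nhds (by linarith : z₀ / 2 < z₀) (by linarith : z₀ < 2 * z₀))]
      with b h3 h4 h5
    rw [dist_zero_right, ← cfc_sub _ _ (Z b) (continuousOn_spectrum _ _)
      (continuousOn_spectrum _ _)]
    refine (norm_cfc_le (half_pos hε).le fun x hx => ?_).trans_lt (half_lt_self hε)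
    have hb : 0 < z b := by linarith [h5.1]
    rw [suppPow_of_pos hb, suppPow_of_pos hz₀, ← dist_eq_norm]
    refine (H (z b, x) ⟨h5, h3 hx⟩ (z₀, x) ⟨⟨by linarith, by linarith⟩, h3 hx⟩ ?_).le
    rw [Prod.dist_eq, dist_self]
    exact max_lt h4 hδ
  simp only [matPow_eq_cfc]
  simpa using h2.add h1

lemma tendsto_Qaz {ρ σ : Matrix ι ι ℂ} (hρ : ρ.PosSemidef) (hσ : σ.PosSemidef)
    {l : Filter ℝ} {α₀ : ℝ} (hl : l ≤ 𝓝 α₀) {z : ℝ → ℝ} {z₀ : ℝ} (hz : Tendsto z l (𝓝 z₀))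
    (hz₀ : 0 < z₀) : Tendsto (fun α => Qaz α (z α) ρ σ) l (𝓝 (Qaz α₀ z₀ ρ σ)) := by
  have hid : Tendsto (fun α : ℝ => α) l (𝓝 α₀) := hl
  have hρt : Tendsto (fun α => matPow ρ (α / (2 * z α))) l (𝓝 (matPow ρ (α₀ / (2 * z₀)))) :=
    ((continuous_matPow ρ).tendsto _).comp
      (hid.div (hz.const_mul 2) (mul_pos two_pos hz₀).ne')
  have hσt : Tendsto (fun α => matPow σ ((1 - α) / z α)) l (𝓝 (matPow σ ((1 - α₀) / z₀))) :=
    ((continuous_matPow σ).tendsto _).comp ((hid.const_sub 1).div hz hz₀.ne')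
  have h := (reTrace_continuous.tendsto _).comp
    (tendsto_matPow_of_tendsto ((hρt.mul hσt).mul hρt)
      (fun α => posSemidef_sandwich α (z α) ρ hσ) (posSemidef_sandwich α₀ z₀ ρ hσ) hz hz₀)
  rw [Qaz_eq_reTrace_matPow_sandwich α₀ hz₀.ne' hρ hσ]
  refine h.congr' ?_
  filter_upwards [hz.eventually (lt_mem_nhds hz₀)] with α hα
  rw [Qaz_eq_reTrace_matPow_sandwich α hα.ne' hρ hσ]
  rfl

lemma tendsto_Daz_of_ne_one {ρ σ : Matrix ι ι ℂ} (hρ : ρ.PosSemidef) (hσ : σ.PosSemidef)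
    {l : Filter ℝ} {α₀ : ℝ} (hα₀ : α₀ ≠ 1) (hl : l ≤ 𝓝 α₀) {z : ℝ → ℝ} {z₀ : ℝ}
    (hz : Tendsto z l (𝓝 z₀)) (hz₀ : 0 < z₀) :
    Tendsto (fun α => Daz α (z α) ρ σ) l (𝓝 (Daz α₀ z₀ ρ σ)) := by
  have hid : Tendsto (fun α : ℝ => α) l (𝓝 α₀) := hl
  have hlt : ∀ᶠ α in l, α < 1 ↔ α₀ < 1 := by
    rcases hα₀.lt_or_gt with h | h
    · filter_upwards [hid.eventually (gt_mem_nhds h)] with α hα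
      exact ⟨fun _ => h, fun _ => hα⟩
    · filter_upwards [hid.eventually (lt_mem_nhds h)] with α hα
      exact ⟨fun h' => absurd h' hα.not_gt, fun h' => absurd h' h.not_gt⟩
  have hcond : ∀ᶠ α in l, ((suppLE ρ σ ∨ α < 1) ∧ Qaz α (z α) ρ σ ≠ 0) ↔
      ((suppLE ρ σ ∨ α₀ < 1) ∧ Qaz α₀ z₀ ρ σ ≠ 0) := by
    filter_upwards [hlt, hz.eventually (lt_mem_nhds hz₀)] with α h1 h2
    rw [h1, Ne, Ne, Qaz_eq_zero_iff hρ hσ α h2.ne', Qaz_eq_zero_iff hρ hσ α₀ hz₀.ne']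
  by_cases h : (suppLE ρ σ ∨ α₀ < 1) ∧ Qaz α₀ z₀ ρ σ ≠ 0
  · rw [Daz, if_pos h]
    have h1 := ((hid.sub_const 1).inv₀ (sub_ne_zero.2 hα₀)).mul
      (((tendsto_Qaz hρ hσ hl hz hz₀).log h.2).sub_const (Real.log (reTrace ρ)))
    refine ((continuous_coe_real_ereal.tendsto _).comp h1).congr' ?_
    filter_upwards [hcond] with α hα
    rw [Daz, if_pos (hα.2 h)]
    rfl
  · rw [Daz, if_neg h]
    refine tendsto_const_nhds.congr' ?_
    filter_upwards [hcond] with α hα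
    rw [Daz, if_neg (mt hα.1 h)]

/-- The limit of `D_{α,z(α)}` at `α = 1` along a path with `z` bounded away from zero. -/
lemma tendsto_Dfull_one {ρ σ : Matrix ι ι ℂ} (hρ : PSDne ρ) (hσ : σ.PosSemidef) {J : Set ℝ}
    {z : ℝ → ℝ} {c : ℝ} (hc : 0 < c) (hz : ∀ᶠ α in 𝓝[J \ {1}] 1, c ≤ z α) :
    Tendsto (fun α => Dfull α (z α) ρ σ) (𝓝[J \ {1}] 1) (𝓝 (DUm ρ σ)) := by
  refine (tendsto_Daz hρ hσ (nhdsWithin_mono 1 fun α hα => hα.2) hc hz).congr' ?_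
  filter_upwards [self_mem_nhdsWithin] with α hα
  exact (if_neg hα.2).symm

end Matrices

/-- For fixed nonzero PSD `ρ, σ` and a continuous
`z : J → (0,∞)` on an interval `J ⊆ (0,∞)`, the map `α ↦ D_{α,z(α)}(ρ‖σ)` is continuous
on `J`; in particular if `1 ∈ J` its limit at `1` is `D_{1,z(1)}(ρ‖σ) = D^Um(ρ‖σ)`.
Moreover the limit at `1` equals `D^Um(ρ‖σ)` whenever `liminf_{α→1} z(α) > 0`. -/
theorem renyi_az_continuous_along_path {n : ℕ} (ρ σ : Matrix (Fin n) (Fin n) ℂ)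
    (hρ : PSDne ρ) (hσ : PSDne σ) (J : Set ℝ) (hJ : J.OrdConnected)
    (hJpos : J ⊆ Set.Ioi (0 : ℝ)) :
    (∀ z : ℝ → ℝ, ContinuousOn z J → (∀ α ∈ J, 0 < z α) →
      ContinuousOn (fun α : ℝ => Dfull α (z α) ρ σ) J ∧
      (1 ∈ J →
        Dfull 1 (z 1) ρ σ = DUm ρ σ ∧
        Filter.Tendsto (fun α : ℝ => Dfull α (z α) ρ σ) (𝓝[J] (1 : ℝ))
          (𝓝 (DUm ρ σ)))) ∧
    (∀ z : ℝ → ℝ, (∀ α ∈ J \ {1}, 0 < z α) →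
      (∃ c : ℝ, 0 < c ∧ ∀ᶠ α in 𝓝[J \ {1}] (1 : ℝ), c ≤ z α) →
      Filter.Tendsto (fun α : ℝ => Dfull α (z α) ρ σ) (𝓝[J \ {1}] (1 : ℝ))
        (𝓝 (DUm ρ σ))) := by
  refine ⟨fun z hz hpos => ?_, fun z _ ⟨c, hc, hcz⟩ => tendsto_Dfull_one hρ hσ.1 hc hcz⟩
  have hone : 1 ∈ J →
      Tendsto (fun α : ℝ => Dfull α (z α) ρ σ) (𝓝[J] (1 : ℝ)) (𝓝 (DUm ρ σ)) := by
    intro h1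
    rw [← insert_eq_of_mem h1, ← insert_sdiff_singleton, nhdsWithin_insert, tendsto_sup]
    refine ⟨?_, tendsto_Dfull_one hρ hσ.1 (half_pos (hpos 1 h1)) ?_⟩
    · rw [tendsto_pure_left]
      intro s hs
      rw [Dfull, if_pos rfl]
      exact mem_of_mem_nhds hs
    · have h2 := (hz 1 h1).mono_left (nhdsWithin_mono 1 (sdiff_subset (t := {1})))
      exact (h2.eventually (lt_mem_nhds (half_lt_self (hpos 1 h1)))).mono fun _ h => h.le
  have hUm : Dfull 1 (z 1) ρ σ = DUm ρ σ := if_pos rfl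
  refine ⟨fun α₀ hα₀ => ?_, fun h1 => ⟨hUm, hone h1⟩⟩
  rcases eq_or_ne α₀ 1 with rfl | hne
  · rw [ContinuousWithinAt, hUm]
    exact hone hα₀
  · have h := tendsto_Daz_of_ne_one hρ.1 hσ.1 hne nhdsWithin_le_nhds (hz α₀ hα₀) (hpos α₀ hα₀)
    rw [ContinuousWithinAt, Dfull, if_neg hne]
    refine h.congr' ?_
    filter_upwards [nhdsWithin_le_nhds (isOpen_ne.mem_nhds hne)] with α hα
    rw [Dfull, if_neg hα]

end QRenyi

end
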